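/- For every sequence of positive integers N(n): lim_{n→∞} ℙ_{N(n)}^n{ λ ∈ 𝕐_{N(n)}^n : −(1/√n)·ln ℙ_{N(n)}^n(λ) < 2π/√6 } = 1. -/

import Mathlib

open MeasureTheory Real Filter Topology
open scoped Classical

noncomputable section

/-- Row lengths of a partition of `n`, `1`-indexed and weakly decreasing
(`rowLen lam i` is the length `λᵢ` of the `i`-th row; it is `0` for `i` beyond
the number of parts). -/
def rowLen {n : ℕ} (lam : Nat.Partition n) (i : ℕ) : ℕ :=
  ((lam.parts.sort (· ≤ ·)).reverse.getD (i - 1) 0)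

/-- Column lengths, i.e. the conjugate partition `λ′ⱼ = #{i : λᵢ ≥ j}`. -/
def colLen {n : ℕ} (lam : Nat.Partition n) (j : ℕ) : ℕ :=
  ((Finset.Icc 1 n).filter (fun i => j ≤ rowLen lam i)).card

/-- The cells `(i, j)` of the Young diagram of `lam`, with `1 ≤ i` and `1 ≤ j ≤ λᵢ`. -/
def cellsOf {n : ℕ} (lam : Nat.Partition n) : Finset (ℕ × ℕ) :=
  (Finset.Icc 1 n ×ˢ Finset.Icc 1 n).filter (fun p => p.2 ≤ rowLen lam p.1)

/-- The hook length `h_{i,j} = (λᵢ − j) + (λ′ⱼ − i) + 1` of the cell `(i,j)`. -/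
def hookLen {n : ℕ} (lam : Nat.Partition n) (i j : ℕ) : ℕ :=
  (rowLen lam i - j) + (colLen lam j - i) + 1

/-- `𝕐_N^n`: Young diagrams with `n` cells and at most `N` rows. -/
def YNN (n N : ℕ) : Finset (Nat.Partition n) :=
  Finset.univ.filter (fun lam => lam.parts.card ≤ N)

/-- `dim E_λ = n! · ∏ (N + c_{i,j}) / (∏ h_{i,j})²`, the dimension of the isotypic
component of `(ℂ^N)^{⊗n}` indexed by `λ` (here the content is `c_{i,j} = j − i`). -/
def dimE (n N : ℕ) (lam : Nat.Partition n) : ℝ :=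
  (n.factorial : ℝ) * (∏ p ∈ cellsOf lam, ((N : ℝ) + (p.2 : ℝ) - (p.1 : ℝ))) /
    (∏ p ∈ cellsOf lam, (hookLen lam p.1 p.2 : ℝ))^2

/-- The probability measure `ℙ_N^n(λ) = dim E_λ / N^n` on `𝕐_N^n`. -/
def PNN (n N : ℕ) (lam : Nat.Partition n) : ℝ := dimE n N lam / (N : ℝ)^n

lemma sum_det_updateRow {m : ℕ} (M T : Matrix (Fin m) (Fin m) ℝ) :
    ∑ i, (M.updateRow i ((M * T) i)).det = T.trace * M.det := by
  have h : ∀ i, (M.updateRow i ((M * T) i)).det = ((M * T) * M.adjugate) i i := by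
    intro i
    rw [← Matrix.cramer_transpose_apply, Matrix.cramer_eq_adjugate_mulVec, ← Matrix.adjugate_transpose,
      Matrix.mul_apply]
    simp only [Matrix.mulVec, dotProduct, Matrix.transpose_apply]
    exact Finset.sum_congr rfl fun k _ => mul_comm _ _
  simp_rw [h]
  change ((M * T) * M.adjugate).trace = _
  rw [Matrix.trace_mul_comm, ← mul_assoc, Matrix.adjugate_mul]
  simp [Matrix.trace_smul, mul_comm]

def VV {N : ℕ} (l : Fin N → ℝ) : ℝ := (Matrix.vandermonde l).det

lemma VV_up {N : ℕ} (l : Fin N → ℝ) :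
    ∑ i, VV (Function.update l i (l i + 1)) = N * VV l := by
  let T : Matrix (Fin N) (Fin N) ℝ := Matrix.of fun a b => ((b : ℕ).choose (a : ℕ) : ℝ)
  have hT : T.trace = N := by simp [Matrix.trace, T]
  rw [VV, ← hT, ← sum_det_updateRow]
  refine Finset.sum_congr rfl fun i _ => ?_
  unfold VV
  congr 1
  ext a b
  by_cases h : a = i
  · subst h
    simp only [Matrix.vandermonde_apply, Function.update_self, Matrix.updateRow_self, Matrix.mul_apply, T, Matrix.of_apply]
    rw [add_pow]
    simp only [one_pow, mul_one]
    rw [Fin.sum_univ_eq_sum_range (fun k => l a ^ k * ((b : ℕ).choose k : ℝ)) N]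
    apply Finset.sum_subset
    · intro x hx; simp at hx ⊢; omega
    · intro x hx hx'
      simp at hx'
      rw [Nat.choose_eq_zero_of_lt (by omega)]; simp
  · simp [Matrix.vandermonde_apply, Function.update_of_ne h, Matrix.updateRow_ne h]

lemma VV_down {N : ℕ} (l : Fin N → ℝ) :
    ∑ i, l i * VV (Function.update l i (l i - 1)) = (∑ i, l i - ∑ i : Fin N, ((i : ℕ) : ℝ)) * VV l := by
  have hV : ∀ l : Fin N → ℝ, VV l = (Matrix.of fun i j : Fin N => (descPochhammer ℝ j).eval (l i)).det := by
    intro l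
    exact Matrix.det_eval_matrixOfPolynomials_eq_det_vandermonde l _
      (fun i => descPochhammer_natDegree _ _) (fun i => monic_descPochhammer _ _)
  set M : Matrix (Fin N) (Fin N) ℝ := Matrix.of fun i j : Fin N => (descPochhammer ℝ j).eval (l i) with hM
  let T : Matrix (Fin N) (Fin N) ℝ := Matrix.diagonal fun i => ((i : ℕ) : ℝ)
  have hT : T.trace = ∑ i : Fin N, ((i : ℕ) : ℝ) := by simp [Matrix.trace, T]
  have key : ∀ i, l i * VV (Function.update l i (l i - 1)) =
      l i * M.det - (M.updateRow i ((M * T) i)).det := by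
    intro i
    have h1 : l i * M.det = (M.updateRow i (l i • M i)).det := by
      rw [Matrix.det_updateRow_smul, Matrix.updateRow_eq_self]
    have h2 : l i * VV (Function.update l i (l i - 1)) =
        (M.updateRow i (l i • M i + (-1 : ℝ) • (M * T) i)).det := by
      rw [hV]
      have : (Matrix.of fun a j : Fin N => (descPochhammer ℝ j).eval (Function.update l i (l i - 1) a)) =
        M.updateRow i (fun j => (descPochhammer ℝ j).eval (l i - 1)) := by
        ext a b
        by_cases h : a = i
        · subst h; simp
        · simp [Function.update_of_ne h, Matrix.updateRow_ne h, hM]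
      rw [this, ← Matrix.det_updateRow_smul]
      congr 2
      ext j
      have e1 := descPochhammer_succ_eval (S := ℝ) (j : ℕ) (l i)
      have e2 : (descPochhammer ℝ ((j : ℕ) + 1)).eval (l i) = l i * (descPochhammer ℝ j).eval (l i - 1) := by
        rw [descPochhammer_succ_left]; simp
      simp only [Pi.smul_apply, Pi.add_apply, smul_eq_mul, T, Matrix.mul_diagonal, hM, Matrix.of_apply]
      rw [← e2, e1]; ring
    rw [h2, h1, Matrix.det_updateRow_add, Matrix.det_updateRow_smul M i (-1)]; ring
  rw [Finset.sum_congr rfl fun i _ => key i, Finset.sum_sub_distrib, sum_det_updateRow, hT, ← Finset.sum_mul, hV]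
  ring

def SS (N s : ℕ) : Finset (Fin N → ℕ) :=
  (Finset.piAntidiag Finset.univ s).filter (fun l => StrictAnti l)

lemma mem_SS {N s : ℕ} {l : Fin N → ℕ} : l ∈ SS N s ↔ ∑ i, l i = s ∧ StrictAnti l := by
  simp [SS]

def WW (N s : ℕ) : ℝ := ∑ l ∈ SS N s, VV (fun i => (l i : ℝ)) ^ 2 / ∏ i, ((l i).factorial : ℝ)

lemma VV_inj {N : ℕ} {l : Fin N → ℕ} (h : VV (fun i => (l i : ℝ)) ≠ 0) : Function.Injective l := by
  have := Matrix.det_vandermonde_ne_zero_iff.1 h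
  intro a b hab
  exact this (by simp [hab])

lemma WW_succ (N n : ℕ) (b : ℕ) (hb : b = ∑ i : Fin N, (i : ℕ)) :
    ((n : ℝ) + 1) * WW N (n + 1 + b) = N * WW N (n + b) := by
  have hup : ∀ (l : Fin N → ℕ) i (x : ℕ), (fun j => ((Function.update l i x) j : ℝ)) =
      Function.update (fun j => (l j : ℝ)) i (x : ℝ) := by
    intro l i x
    ext j
    by_cases h : j = i
    · subst h; simp
    · simp [Function.update_of_ne h]
  have hL : ((n : ℝ) + 1) * WW N (n + 1 + b) = ∑ p ∈ SS N (n + 1 + b) ×ˢ (Finset.univ : Finset (Fin N)),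
      VV (fun i => (p.1 i : ℝ)) * ((p.1 p.2 : ℝ) * VV (Function.update (fun i => (p.1 i : ℝ)) p.2 ((p.1 p.2 : ℝ) - 1)))
        / ∏ i, ((p.1 i).factorial : ℝ) := by
    rw [WW, Finset.sum_product, Finset.mul_sum]
    refine Finset.sum_congr rfl fun l hl => ?_
    dsimp only
    rw [← Finset.sum_div, ← Finset.mul_sum, VV_down]
    have : (∑ i, (l i : ℝ)) = n + 1 + b := by exact_mod_cast (mem_SS.1 hl).1
    rw [this, hb]; push_cast; ring
  have hR : N * WW N (n + b) = ∑ p ∈ SS N (n + b) ×ˢ (Finset.univ : Finset (Fin N)),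
      VV (fun i => (p.1 i : ℝ)) * (VV (Function.update (fun i => (p.1 i : ℝ)) p.2 ((p.1 p.2 : ℝ) + 1)))
        / ∏ i, ((p.1 i).factorial : ℝ) := by
    rw [WW, Finset.sum_product, Finset.mul_sum]
    refine Finset.sum_congr rfl fun l hl => ?_
    dsimp only
    rw [← Finset.sum_div, ← Finset.mul_sum, VV_up]
    ring
  rw [hL, hR]
  have hsum : ∀ (l : Fin N → ℕ) i x, ∑ j, (Function.update l i x) j + l i = ∑ j, l j + x := by
    intro l i x
    rw [Finset.sum_update_of_mem (Finset.mem_univ i), ← Finset.sum_sdiff (Finset.subset_univ {i})]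
    simp; ring
  refine Finset.sum_bij_ne_zero (fun p _ _ => (Function.update p.1 p.2 (p.1 p.2 - 1), p.2)) ?_ ?_ ?_ ?_
  · rintro ⟨l, i⟩ h hne
    simp only [Finset.mem_product, mem_SS, Finset.mem_univ, and_true] at h ⊢
    have h0 : l i ≠ 0 := by rintro h0; simp [h0] at hne
    have hV : VV (fun j => ((Function.update l i (l i - 1)) j : ℝ)) ≠ 0 := by
      rw [hup, Nat.cast_sub (by omega), Nat.cast_one]
      intro hh; simp [hh] at hne
    refine ⟨by have := hsum l i (l i - 1); omega, ?_⟩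
    refine Antitone.strictAnti_of_injective ?_ (VV_inj hV)
    intro a c hac
    rcases hac.eq_or_lt with rfl | hac
    · exact le_rfl
    have := h.2 hac
    simp only [Function.update_apply]
    split_ifs <;> subst_vars <;> omega
  · rintro ⟨l, i⟩ h hne ⟨l', i'⟩ h' hne' heq
    have h0 : l i ≠ 0 := by rintro h0; simp [h0] at hne
    have h0' : l' i' ≠ 0 := by rintro h0; simp [h0] at hne'
    simp only [Prod.mk.injEq] at heq ⊢
    obtain ⟨h1, rfl⟩ := heq
    refine ⟨?_, rfl⟩
    ext j
    have := congrFun h1 j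
    by_cases hj : j = i
    · subst hj; simp at this; omega
    · simpa [Function.update_of_ne hj] using this
  · rintro ⟨l, i⟩ h hne
    simp only [Finset.mem_product, mem_SS, Finset.mem_univ, and_true] at h
    have hV : VV (fun j => ((Function.update l i (l i + 1)) j : ℝ)) ≠ 0 := by
      rw [hup]; push_cast
      intro hh; simp [hh] at hne
    have hm : (Function.update l i (l i + 1)) ∈ SS N (n + 1 + b) := by
      rw [mem_SS]
      refine ⟨by have := hsum l i (l i + 1); omega, ?_⟩
      refine Antitone.strictAnti_of_injective ?_ (VV_inj hV)
      intro a c hac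
      rcases hac.eq_or_lt with rfl | hac
      · exact le_rfl
      have := h.2 hac
      simp only [Function.update_apply]
      split_ifs <;> subst_vars <;> omega
    refine ⟨(Function.update l i (l i + 1), i), by simpa using hm, ?_, by simp⟩
    have hl : VV (fun j => (l j : ℝ)) ≠ 0 := by
      intro hh; simp [hh] at hne
    simp only [hup]
    simp only [Function.update_self, Function.update_idem]
    push_cast
    rw [hup] at hV; push_cast at hV
    simp only [add_sub_cancel_right, Function.update_eq_self]
    refine div_ne_zero (mul_ne_zero hV (mul_ne_zero (by positivity) hl)) ?_
    exact Finset.prod_ne_zero_iff.2 fun j _ => by positivity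
  · rintro ⟨l, i⟩ h hne
    have h0 : l i ≠ 0 := by rintro h0; simp [h0] at hne
    obtain ⟨k, hk⟩ := Nat.exists_eq_succ_of_ne_zero h0
    simp only [hup]
    simp only [Function.update_self, Function.update_idem, hk, Nat.succ_sub_one]
    push_cast
    have e : Function.update (fun j => (l j : ℝ)) i ((k : ℝ) + 1) = fun j => (l j : ℝ) := by
      rw [Function.update_eq_self_iff]; simp [hk]
    rw [e]
    simp only [add_sub_cancel_right]
    have hp : ∏ j, ((l j).factorial : ℝ) = (k + 1) * ∏ j, (((Function.update l i k) j).factorial : ℝ) := by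
      rw [← Finset.mul_prod_erase _ _ (Finset.mem_univ i), ← Finset.mul_prod_erase _ (fun j => (((Function.update l i k) j).factorial : ℝ)) (Finset.mem_univ i), ← mul_assoc]
      congr 1
      · simp [hk, Nat.factorial_succ]
      · refine Finset.prod_congr rfl fun j hj => ?_
        rw [Function.update_of_ne (Finset.ne_of_mem_erase hj)]
    have hp0 : ∏ j, (((Function.update l i k) j).factorial : ℝ) ≠ 0 :=
      Finset.prod_ne_zero_iff.2 fun j _ => by positivity
    rw [hp]
    have : (k : ℝ) + 1 ≠ 0 := by positivity
    field_simp

lemma WW_eq (N n : ℕ) (b : ℕ) (hb : b = ∑ i : Fin N, (i : ℕ)) :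
    (n.factorial : ℝ) * WW N (n + b) = (N : ℝ) ^ n * WW N (0 + b) := by
  induction n with
  | zero => simp
  | succ n ih =>
    have := WW_succ N n b hb
    rw [Nat.factorial_succ]; push_cast
    linear_combination (n.factorial : ℝ) * this + N * ih

lemma part_bound (n : ℕ) (x : ℝ) (hx0 : 0 < x) (hx1 : x < 1) :
    (Fintype.card (Nat.Partition n) : ℝ) * x ^ n ≤ ∏ i ∈ Finset.Icc 2 n, (1 - x ^ i)⁻¹ := by
  have h1 : ∀ i ∈ Finset.Icc 2 n, ∑ m ∈ Finset.range (n + 1), (x ^ i) ^ m ≤ (1 - x ^ i)⁻¹ := by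
    intro i hi
    have hi2 : 2 ≤ i := (Finset.mem_Icc.1 hi).1
    rw [← tsum_geometric_of_lt_one (by positivity) (pow_lt_one₀ hx0.le hx1 (by omega))]
    exact (summable_geometric_of_lt_one (by positivity) (pow_lt_one₀ hx0.le hx1 (by omega))).sum_le_tsum _
      (fun _ _ => by positivity)
  refine le_trans ?_ (Finset.prod_le_prod (fun i _ => Finset.sum_nonneg fun _ _ => by positivity) h1)
  rw [Finset.prod_sum]
  let φ : Nat.Partition n → (∀ i ∈ Finset.Icc 2 n, ℕ) := fun lam i _ => lam.parts.count i
  have hsum : ∀ lam : Nat.Partition n, ∑ i ∈ Finset.Icc 1 n, lam.parts.count i * i = n := by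
    intro lam
    conv_rhs => rw [← lam.parts_sum]
    rw [Finset.sum_multiset_count_of_subset lam.parts (Finset.Icc 1 n)]
    · simp
    · intro i hi
      rw [Multiset.mem_toFinset] at hi
      have := lam.parts_pos hi
      have := Multiset.le_sum_of_mem hi
      rw [lam.parts_sum] at this
      simp; omega
  have hle : ∀ lam : Nat.Partition n, ∑ i ∈ Finset.Icc 2 n, lam.parts.count i * i ≤ n := by
    intro lam
    conv_rhs => rw [← hsum lam]
    apply Finset.sum_le_sum_of_subset
    intro i; simp; omega
  have hinj : Function.Injective φ := by
    intro a b hab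
    have h2 : ∀ i, 2 ≤ i → i ≤ n → a.parts.count i = b.parts.count i := by
      intro i hi hi'
      exact congrFun (congrFun hab i) (Finset.mem_Icc.2 ⟨hi, hi'⟩)
    have hz : ∀ (a : Nat.Partition n) i, (i = 0 ∨ n < i) → a.parts.count i = 0 := by
      intro a i hi
      rw [Multiset.count_eq_zero]
      intro hm
      have := a.parts_pos hm
      have := Multiset.le_sum_of_mem hm
      rw [a.parts_sum] at this
      omega
    ext i
    by_cases hi : i = 0 ∨ n < i
    · rw [hz a i hi, hz b i hi]
    by_cases hi2 : 2 ≤ i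
    · exact h2 i hi2 (by omega)
    have hi1 : i = 1 := by omega
    subst hi1
    have ha := hsum a
    have hb := hsum b
    have hI : Finset.Icc 1 n = insert 1 (Finset.Icc 2 n) := by
      ext j; simp; omega
    rw [hI, Finset.sum_insert (by simp)] at ha hb
    have : ∑ i ∈ Finset.Icc 2 n, a.parts.count i * i = ∑ i ∈ Finset.Icc 2 n, b.parts.count i * i :=
      Finset.sum_congr rfl fun i hi => by rw [h2 i (Finset.mem_Icc.1 hi).1 (Finset.mem_Icc.1 hi).2]
    omega
  have hcard : (Fintype.card (Nat.Partition n) : ℝ) * x ^ n = ∑ lam : Nat.Partition n, x ^ n := by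
    simp
  rw [hcard]
  calc ∑ lam : Nat.Partition n, x ^ n
      ≤ ∑ lam : Nat.Partition n, ∏ i ∈ (Finset.Icc 2 n).attach, (x ^ (i : ℕ)) ^ (φ lam i.1 i.2) := by
        refine Finset.sum_le_sum fun lam _ => ?_
        have : ∏ i ∈ (Finset.Icc 2 n).attach, (x ^ (i : ℕ)) ^ (φ lam i.1 i.2) =
            x ^ (∑ i ∈ Finset.Icc 2 n, lam.parts.count i * i) := by
          rw [Finset.prod_attach (Finset.Icc 2 n) (fun i => (x ^ i) ^ (lam.parts.count i)),
            ← Finset.prod_pow_eq_pow_sum]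
          exact Finset.prod_congr rfl fun i _ => by rw [← pow_mul, mul_comm]
        rw [this]
        exact pow_le_pow_of_le_one hx0.le hx1.le (hle lam)
    _ = ∑ p ∈ Finset.univ.image φ, ∏ i ∈ (Finset.Icc 2 n).attach, (x ^ (i : ℕ)) ^ (p i.1 i.2) := by
        rw [Finset.sum_image (fun a _ b _ h => hinj h)]
    _ ≤ _ := by
        refine Finset.sum_le_sum_of_subset_of_nonneg ?_ (fun _ _ _ => Finset.prod_nonneg fun _ _ => by positivity)
        intro p hp
        obtain ⟨lam, -, rfl⟩ := Finset.mem_image.1 hp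
        rw [Finset.mem_pi]
        intro i hi
        have h := (Finset.single_le_sum (f := fun i => lam.parts.count i * i) (fun _ _ => Nat.zero_le _) hi).trans (hle lam)
        have hi2 := (Finset.mem_Icc.1 hi).1
        rw [Finset.mem_range]
        change lam.parts.count i < n + 1
        nlinarith [Nat.zero_le (lam.parts.count i)]

lemma log_bound (n : ℕ) (t : ℝ) (ht : 0 < t) :
    ∑ i ∈ Finset.Icc 1 n, -Real.log (1 - Real.exp (-t) ^ i) ≤ π ^ 2 / (6 * t) := by
  set x := Real.exp (-t) with hx
  have hx0 : 0 < x := Real.exp_pos _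
  have hx1 : x < 1 := by rw [hx, Real.exp_lt_one_iff]; linarith
  have h1 : ∀ i ∈ Finset.Icc 1 n, HasSum (fun k : ℕ => (x ^ i) ^ (k + 1) / ((k : ℝ) + 1)) (-Real.log (1 - x ^ i)) := by
    intro i hi
    have hi1 := (Finset.mem_Icc.1 hi).1
    apply Real.hasSum_pow_div_log_of_abs_lt_one
    rw [abs_of_pos (by positivity)]
    exact pow_lt_one₀ hx0.le hx1 (by omega)
  have h2 := hasSum_sum h1
  have h3 : HasSum (fun k : ℕ => (1 / t) * (1 / ((k : ℝ) + 1) ^ 2)) ((1 / t) * (π ^ 2 / 6)) := by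
    apply HasSum.mul_left
    have := hasSum_zeta_two
    have h := (hasSum_nat_add_iff' 1).2 this
    simpa using h
  refine (hasSum_le ?_ h2 h3).trans (le_of_eq (by field_simp))
  intro k
  rw [← Finset.sum_div]
  have hk : (0 : ℝ) < (k : ℝ) + 1 := by positivity
  have h4 : ∑ i ∈ Finset.Icc 1 n, (x ^ i) ^ (k + 1) ≤ 1 / (((k : ℝ) + 1) * t) := by
    set y := x ^ (k + 1) with hy
    have hy0 : 0 < y := by positivity
    have hy1 : y < 1 := pow_lt_one₀ hx0.le hx1 (by omega)
    have e : ∑ i ∈ Finset.Icc 1 n, (x ^ i) ^ (k + 1) = y * ∑ i ∈ Finset.range n, y ^ i := by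
      rw [Finset.mul_sum, Finset.range_eq_Ico, ← Finset.Ico_add_one_right_eq_Icc,
        ← Finset.sum_Ico_add' (fun i => (x ^ i) ^ (k + 1)) 0 n 1]
      refine Finset.sum_congr rfl fun i _ => ?_
      rw [hy]; ring
    have e2 : ∑ i ∈ Finset.range n, y ^ i ≤ (1 - y)⁻¹ := by
      rw [← tsum_geometric_of_lt_one hy0.le hy1]
      exact (summable_geometric_of_lt_one hy0.le hy1).sum_le_tsum _ (fun _ _ => by positivity)
    rw [e]
    refine (mul_le_mul_of_nonneg_left e2 hy0.le).trans ?_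
    have h1y : 0 < 1 - y := by linarith
    rw [← div_eq_mul_inv, div_le_div_iff₀ h1y (by positivity), one_mul]
    have e3 : y = Real.exp (-(((k : ℝ) + 1) * t)) := by
      rw [hy, hx, ← Real.exp_nat_mul]; push_cast; ring_nf
    have e4 := Real.add_one_le_exp (((k : ℝ) + 1) * t)
    have e5 : y * Real.exp (((k : ℝ) + 1) * t) = 1 := by
      rw [e3, ← Real.exp_add]; simp
    nlinarith
  calc _ ≤ 1 / (((k : ℝ) + 1) * t) / ((k : ℝ) + 1) := by gcongr
    _ = _ := by field_simp

lemma part_bound2 (n : ℕ) (hn : 1 ≤ n) (t : ℝ) (ht : 0 < t) :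
    (Fintype.card (Nat.Partition n) : ℝ) ≤ t * Real.exp (n * t + π ^ 2 / (6 * t)) := by
  set x := Real.exp (-t) with hx
  have hx0 : 0 < x := Real.exp_pos _
  have hx1 : x < 1 := by rw [hx, Real.exp_lt_one_iff]; linarith
  have h1 := part_bound n x hx0 hx1
  have h2 := log_bound n t ht
  rw [← hx] at h2
  have hI : Finset.Icc 1 n = insert 1 (Finset.Icc 2 n) := by
    ext j; simp; omega
  have hpos : ∀ i ∈ Finset.Icc 1 n, 0 < 1 - x ^ i := by
    intro i hi
    have := pow_lt_one₀ hx0.le hx1 (n := i) (by have := (Finset.mem_Icc.1 hi).1; omega)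
    linarith
  have h3 : ∏ i ∈ Finset.Icc 1 n, (1 - x ^ i)⁻¹ ≤ Real.exp (π ^ 2 / (6 * t)) := by
    refine le_trans (le_of_eq ?_) (Real.exp_le_exp.2 h2)
    rw [Real.exp_sum]
    refine Finset.prod_congr rfl fun i hi => ?_
    rw [Real.exp_neg, Real.exp_log (hpos i hi)]
  rw [hI, Finset.prod_insert (by simp), pow_one] at h3
  have h4 : 0 < 1 - x := by linarith
  have h5 : 1 - x ≤ t := by have := Real.add_one_le_exp (-t); rw [← hx] at this; linarith
  have h6 : ∏ i ∈ Finset.Icc 2 n, (1 - x ^ i)⁻¹ ≤ t * Real.exp (π ^ 2 / (6 * t)) := by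
    rw [inv_mul_le_iff₀ h4] at h3
    refine h3.trans (by gcongr)
  have h7 : x ^ n * Real.exp (n * t) = 1 := by
    rw [hx, ← Real.exp_nat_mul, ← Real.exp_add]; simp
  calc (Fintype.card (Nat.Partition n) : ℝ) = (Fintype.card (Nat.Partition n) : ℝ) * x ^ n * Real.exp (n * t) := by
        rw [mul_assoc, h7, mul_one]
    _ ≤ t * Real.exp (π ^ 2 / (6 * t)) * Real.exp (n * t) := mul_le_mul_of_nonneg_right (h1.trans h6) (Real.exp_pos _).le
    _ = _ := by rw [mul_assoc, ← Real.exp_add, add_comm]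

lemma part_tendsto : Tendsto (fun n : ℕ => (Fintype.card (Nat.Partition n) : ℝ) *
    Real.exp (-(2 * π / Real.sqrt 6 * Real.sqrt n))) atTop (𝓝 0) := by
  have h0 : Tendsto (fun n : ℕ => π / Real.sqrt 6 / Real.sqrt n) atTop (𝓝 0) :=
    Tendsto.div_atTop tendsto_const_nhds (Real.tendsto_sqrt_atTop.comp tendsto_natCast_atTop_atTop)
  refine tendsto_of_tendsto_of_tendsto_of_le_of_le' tendsto_const_nhds h0
    (Eventually.of_forall fun n => by positivity) ?_
  filter_upwards [eventually_ge_atTop 1] with n hn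
  have hn0 : (0 : ℝ) < n := by exact_mod_cast hn
  have hs : 0 < Real.sqrt n := Real.sqrt_pos.2 hn0
  have hs6 : 0 < Real.sqrt 6 := by positivity
  have hpi := Real.pi_pos
  have h := part_bound2 n hn (π / Real.sqrt 6 / Real.sqrt n) (by positivity)
  have e : n * (π / Real.sqrt 6 / Real.sqrt n) + π ^ 2 / (6 * (π / Real.sqrt 6 / Real.sqrt n)) = 2 * π / Real.sqrt 6 * Real.sqrt n := by
    have a1 := Real.sq_sqrt hn0.le
    have a2 := Real.sq_sqrt (show (0 : ℝ) ≤ 6 by norm_num)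
    set s := Real.sqrt n
    set q := Real.sqrt 6
    rw [← a1, ← a2]
    field_simp
    ring
  rw [e] at h
  rw [Real.exp_neg, ← div_eq_mul_inv, div_le_iff₀ (Real.exp_pos _)]
  exact h

lemma final (N : ℕ → ℕ) (hN : ∀ n, 0 < N n)
    (hpos : ∀ n, ∀ lam ∈ YNN n (N n), 0 < PNN n (N n) lam)
    (hsum : ∀ n, ∑ lam ∈ YNN n (N n), PNN n (N n) lam = 1) :
      Tendsto (fun n : ℕ =>
          ∑ lam ∈ (YNN n (N n)).filter (fun lam =>
              -(1/Real.sqrt n) * Real.log (PNN n (N n) lam) < 2*π/Real.sqrt 6),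
            PNN n (N n) lam)
        atTop (𝓝 1) := by
  have h0 := part_tendsto.const_sub 1
  rw [sub_zero] at h0
  refine tendsto_of_tendsto_of_tendsto_of_le_of_le' h0 tendsto_const_nhds ?_ ?_
  · filter_upwards [eventually_ge_atTop 1] with n hn
    have hn0 : (0 : ℝ) < n := by exact_mod_cast hn
    have hs : 0 < Real.sqrt n := Real.sqrt_pos.2 hn0
    have hs1 := hsum n
    rw [← Finset.sum_filter_add_sum_filter_not (YNN n (N n)) (fun lam =>
              -(1/Real.sqrt n) * Real.log (PNN n (N n) lam) < 2*π/Real.sqrt 6)] at hs1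
    rw [sub_le_iff_le_add]
    refine hs1.ge.trans ?_
    rw [add_le_add_iff_left]
    refine (Finset.sum_le_card_nsmul _ _ (Real.exp (-(2 * π / Real.sqrt 6 * Real.sqrt n))) ?_).trans ?_
    · intro lam hl
      rw [Finset.mem_filter, not_lt] at hl
      rw [← Real.log_le_iff_le_exp (hpos n lam hl.1)]
      have := mul_le_mul_of_nonneg_right hl.2 hs.le
      have e : -(1/Real.sqrt n) * Real.log (PNN n (N n) lam) * Real.sqrt n = - Real.log (PNN n (N n) lam) := by
        field_simp
      linarith
    · rw [nsmul_eq_mul]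
      gcongr
      exact Finset.card_le_univ _
  · refine Eventually.of_forall fun n => ?_
    rw [← hsum n]
    exact Finset.sum_le_sum_of_subset_of_nonneg (Finset.filter_subset _ _) (fun lam h _ => (hpos n lam h).le)

def LL {n : ℕ} (lam : Nat.Partition n) : List ℕ := (lam.parts.sort (· ≤ ·)).reverse

lemma LL_pairwise {n : ℕ} (lam : Nat.Partition n) : (LL lam).Pairwise (· ≥ ·) := by
  rw [LL, List.pairwise_reverse]
  exact Multiset.pairwise_sort _ _

lemma LL_coe {n : ℕ} (lam : Nat.Partition n) : (LL lam : Multiset ℕ) = lam.parts := by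
  rw [LL, Multiset.coe_reverse, Multiset.sort_eq]

lemma LL_length {n : ℕ} (lam : Nat.Partition n) : (LL lam).length = lam.parts.card := by
  rw [← LL_coe]; rfl

lemma LL_sum {n : ℕ} (lam : Nat.Partition n) : (LL lam).sum = n := by
  rw [← Multiset.sum_coe, LL_coe, lam.parts_sum]

lemma LL_pos {n : ℕ} (lam : Nat.Partition n) : ∀ x ∈ LL lam, 0 < x := by
  intro x hx
  apply lam.parts_pos
  rw [← LL_coe]; exact hx

lemma rowLen_eq {n : ℕ} (lam : Nat.Partition n) (i : ℕ) : rowLen lam i = (LL lam).getD (i - 1) 0 := rfl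

lemma getD_anti {L : List ℕ} (h : L.Pairwise (· ≥ ·)) {i j : ℕ} (hij : i ≤ j) : L.getD j 0 ≤ L.getD i 0 := by
  by_cases hj : j < L.length
  · rcases hij.eq_or_lt with rfl | hlt
    · exact le_rfl
    rw [List.getD_eq_getElem _ _ hj, List.getD_eq_getElem _ _ (by omega)]
    exact List.pairwise_iff_getElem.1 h i j (by omega) hj hlt
  · rw [List.getD_eq_default _ _ (by omega)]; omega

lemma rowLen_anti {n : ℕ} (lam : Nat.Partition n) {i j : ℕ} (hij : i ≤ j) : rowLen lam j ≤ rowLen lam i :=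
  getD_anti (LL_pairwise lam) (by omega)

lemma rowLen_zero {n : ℕ} (lam : Nat.Partition n) {i : ℕ} (h : lam.parts.card < i) : rowLen lam i = 0 := by
  rw [rowLen_eq, List.getD_eq_default]
  rw [LL_length]; omega

lemma sum_getD (L : List ℕ) : ∀ N, L.length ≤ N → ∑ i ∈ Finset.range N, L.getD i 0 = L.sum := by
  induction L with
  | nil => intro N _; simp
  | cons x xs ih =>
    intro N hN
    obtain ⟨M, rfl⟩ : ∃ M, N = M + 1 := ⟨N - 1, by simp at hN; omega⟩
    rw [Finset.sum_range_succ', List.sum_cons, ← ih M (by simpa using hN)]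
    simp [add_comm]

lemma rowLen_sum {n : ℕ} (lam : Nat.Partition n) (N : ℕ) (h : lam.parts.card ≤ N) :
    ∑ i ∈ Finset.range N, rowLen lam (i + 1) = n := by
  conv_rhs => rw [← LL_sum lam]
  rw [← sum_getD (LL lam) N (by rw [LL_length]; exact h)]
  rfl

lemma card_le {n : ℕ} (lam : Nat.Partition n) : lam.parts.card ≤ n := by
  have := Multiset.card_nsmul_le_sum (s := lam.parts) (a := 1) (fun x hx => lam.parts_pos hx)
  rw [lam.parts_sum] at this
  simpa using this

lemma rowLen_le {n : ℕ} (lam : Nat.Partition n) (i : ℕ) : rowLen lam i ≤ n := by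
  refine (rowLen_anti lam (Nat.zero_le i)).trans ?_
  have h : rowLen lam 0 = rowLen lam (0 + 1) := rfl
  rw [h]
  conv_rhs => rw [← rowLen_sum lam (n + 1) ((card_le lam).trans (by omega))]
  exact Finset.single_le_sum (f := fun i => rowLen lam (i + 1)) (fun _ _ => Nat.zero_le _) (by simp)

lemma list_ext0 : ∀ (L M : List ℕ), (∀ x ∈ L, 0 < x) → (∀ x ∈ M, 0 < x) →
    (∀ i, L.getD i 0 = M.getD i 0) → L = M
  | [], [], _, _, _ => rfl
  | [], y :: ys, _, h2, h => by
    have := h 0; have := h2 y (by simp); simp at *; omega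
  | x :: xs, [], h1, _, h => by
    have := h 0; have := h1 x (by simp); simp at *; omega
  | x :: xs, y :: ys, h1, h2, h => by
    have h0 := h 0
    simp only [List.getD_cons_zero] at h0
    subst h0
    rw [list_ext0 xs ys (fun z hz => h1 z (by simp [hz])) (fun z hz => h2 z (by simp [hz]))
      (fun i => by simpa using h (i + 1))]

lemma filter_getD : ∀ (L : List ℕ), L.Pairwise (· ≥ ·) → ∀ i, (L.filter (· ≠ 0)).getD i 0 = L.getD i 0
  | [], _, _ => rfl
  | x :: xs, h, i => by
    rw [List.pairwise_cons] at h
    by_cases hx : x = 0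
    · subst hx
      have h0 : ∀ y ∈ xs, y = 0 := fun y hy => by have := h.1 y hy; omega
      have e : (0 :: xs).filter (· ≠ 0) = [] := by
        rw [List.filter_eq_nil_iff]; intro a ha
        rcases List.mem_cons.1 ha with rfl | ha
        · simp
        · simp [h0 a ha]
      rw [e]
      by_cases hi : i < (0 :: xs).length
      · rw [List.getD_eq_getElem _ _ hi]
        rcases List.mem_cons.1 (List.getElem_mem hi) with h1 | h1
        · rw [h1]; simp
        · rw [h0 _ h1]; simp
      · rw [List.getD_eq_default (0 :: xs) _ (by omega)]; simp
    · rw [List.filter_cons_of_pos (by simpa using hx)]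
      cases i with
      | zero => simp
      | succ i => simpa using filter_getD xs h.2 i

def ll (N : ℕ) {n : ℕ} (lam : Nat.Partition n) : Fin N → ℕ := fun i => rowLen lam (i + 1) + (N - 1 - i)

lemma sum_rev (N : ℕ) : ∑ i : Fin N, (N - 1 - (i : ℕ)) = ∑ i : Fin N, (i : ℕ) := by
  rw [Fin.sum_univ_eq_sum_range (fun i => N - 1 - i) N, Fin.sum_univ_eq_sum_range (fun i => i) N]
  exact Finset.sum_range_reflect (fun i => i) N

lemma ll_strict (N : ℕ) {n : ℕ} (lam : Nat.Partition n) : StrictAnti (ll N lam) := by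
  intro i j hij
  have h := rowLen_anti lam (show (i : ℕ) + 1 ≤ j + 1 by have : (i : ℕ) < j := hij; omega)
  have h2 : (i : ℕ) < j := hij
  have := j.2
  unfold ll
  omega

lemma bij_sum (n N : ℕ) (G : (Fin N → ℕ) → ℝ) :
    ∑ lam ∈ YNN n N, G (ll N lam) = ∑ l ∈ SS N (n + ∑ i : Fin N, (i : ℕ)), G l := by
  refine Finset.sum_bij (fun lam _ => ll N lam) ?_ ?_ ?_ (fun _ _ => rfl)
  · intro lam hl
    have hc : lam.parts.card ≤ N := by simpa [YNN] using hl
    rw [mem_SS]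
    refine ⟨?_, ll_strict N lam⟩
    unfold ll
    rw [Finset.sum_add_distrib, sum_rev, Fin.sum_univ_eq_sum_range (fun i => rowLen lam (i + 1)) N, rowLen_sum lam N hc]
  · intro lam hl mu hm heq
    have hc : lam.parts.card ≤ N := by simpa [YNN] using hl
    have hc' : mu.parts.card ≤ N := by simpa [YNN] using hm
    have : LL lam = LL mu := by
      apply list_ext0 _ _ (LL_pos _) (LL_pos _)
      intro i
      by_cases hi : i < N
      · have := congrFun heq ⟨i, hi⟩
        simp only [ll, rowLen_eq, Nat.add_sub_cancel] at this
        omega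
      · rw [List.getD_eq_default _ _ (by rw [LL_length]; omega), List.getD_eq_default _ _ (by rw [LL_length]; omega)]
    apply Nat.Partition.ext
    rw [← LL_coe, ← LL_coe, this]
  · intro l hl
    rw [mem_SS] at hl
    obtain ⟨hs, hst⟩ := hl
    have hge : ∀ k : ℕ, ∀ i : Fin N, N - 1 - (i : ℕ) = k → k ≤ l i := by
      intro k
      induction k with
      | zero => intro i _; omega
      | succ k ih =>
        intro i hi
        have hi2 := i.2
        have := ih ⟨i + 1, by omega⟩ (by simp; omega)
        have h3 : l ⟨i + 1, by omega⟩ < l i := hst (by rw [Fin.lt_def]; simp)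
        omega
    let a : Fin N → ℕ := fun i => l i - (N - 1 - i)
    have hla : ∀ i, l i = a i + (N - 1 - i) := fun i => by have := hge _ i rfl; simp only [a]; omega
    have hstep : ∀ d : ℕ, ∀ i j : Fin N, (j : ℕ) = i + d → l j + d ≤ l i := by
      intro d
      induction d with
      | zero => intro i j h; have : j = i := Fin.ext (by omega)
                subst this; omega
      | succ d ih =>
        intro i j h
        have hj := j.2
        have h1 := ih i ⟨i + d, by omega⟩ rfl
        have h3 : l j < l ⟨i + d, by omega⟩ := hst (by rw [Fin.lt_def]; simp; omega)
        omega
    have haa : Antitone a := by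
      intro i j hij
      have hij' : (i : ℕ) ≤ j := hij
      have := hstep (j - i) i j (by omega)
      have := hla i
      have := hla j
      have := j.2
      omega
    have hsa : ∑ i, a i = n := by
      have h1 : ∑ i, l i = ∑ i, a i + ∑ i : Fin N, (N - 1 - (i : ℕ)) := by
        rw [← Finset.sum_add_distrib]; exact Finset.sum_congr rfl fun i _ => hla i
      rw [sum_rev] at h1
      omega
    let L := List.ofFn a
    have hLs : (L : Multiset ℕ).sum = n := by
      rw [Multiset.sum_coe, List.sum_ofFn, hsa]
    have hLp : L.Pairwise (· ≥ ·) := by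
      rw [List.pairwise_ofFn]
      intro i j hij
      exact haa hij.le
    let lam := Nat.Partition.ofSums n (L : Multiset ℕ) hLs
    have hparts : lam.parts = ((L.filter (· ≠ 0) : List ℕ) : Multiset ℕ) := by
      simp [lam]
    have hLL : LL lam = L.filter (· ≠ 0) := by
      have hp : (LL lam).Perm (L.filter (· ≠ 0)) := by
        rw [← Multiset.coe_eq_coe, LL_coe, hparts]
      exact hp.eq_of_pairwise (fun a b _ _ h1 h2 => le_antisymm h2 h1) (LL_pairwise lam) (hLp.filter _)
    refine ⟨lam, ?_, ?_⟩
    · simp only [YNN, Finset.mem_filter, Finset.mem_univ, true_and]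
      rw [← LL_length, hLL]
      refine (List.length_filter_le _ _).trans ?_
      simp [L]
    · ext i
      rw [hla i, ll, rowLen_eq, hLL, Nat.add_sub_cancel, filter_getD L hLp]
      congr 1
      rw [List.getD_eq_getElem _ _ (by simp [L])]
      simp [L]

lemma prod_cells {n N : ℕ} (lam : Nat.Partition n) (h : lam.parts.card ≤ N) (F : ℕ → ℕ → ℝ) :
    ∏ p ∈ cellsOf lam, F p.1 p.2 = ∏ i : Fin N, ∏ j ∈ Finset.Icc 1 (rowLen lam (i + 1)), F (i + 1) j := by
  rw [Finset.prod_finset_product' (cellsOf lam) (Finset.Icc 1 N) (fun i => Finset.Icc 1 (rowLen lam i))]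
  · rw [Fin.prod_univ_eq_prod_range (fun i => ∏ j ∈ Finset.Icc 1 (rowLen lam (i + 1)), F (i + 1) j) N,
      Finset.range_eq_Ico, Finset.prod_Ico_add' (fun i => ∏ j ∈ Finset.Icc 1 (rowLen lam i), F i j) 0 N 1]
    rfl
  · rintro ⟨i, j⟩
    have h1 : lam.parts.card < i → rowLen lam i = 0 := fun h => rowLen_zero lam h
    have h2 := rowLen_le lam i
    have h3 := card_le lam
    simp only [cellsOf, Finset.mem_filter, Finset.mem_product, Finset.mem_Icc]
    constructor
    · rintro ⟨⟨h4, h5⟩, h6⟩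
      refine ⟨⟨h4.1, ?_⟩, h5.1, h6⟩
      by_contra h7
      have := h1 (by omega)
      omega
    · rintro ⟨h4, h5⟩
      refine ⟨⟨⟨h4.1, ?_⟩, h5.1, by omega⟩, h5.2⟩
      by_contra h7
      have := h1 (by omega)
      omega

lemma le_colLen {n : ℕ} (lam : Nat.Partition n) {k j : ℕ} (hk : 1 ≤ k) (hj : 1 ≤ j) :
    j ≤ rowLen lam k ↔ k ≤ colLen lam j := by
  have h1 : lam.parts.card < k → rowLen lam k = 0 := fun h => rowLen_zero lam h
  have h3 := card_le lam
  constructor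
  · intro h
    have hkn : k ≤ n := by
      by_contra h7
      have := h1 (by omega)
      omega
    calc k = (Finset.Icc 1 k).card := by simp
      _ ≤ _ := by
        apply Finset.card_le_card
        intro i hi
        rw [Finset.mem_Icc] at hi
        rw [Finset.mem_filter, Finset.mem_Icc]
        exact ⟨⟨hi.1, by omega⟩, h.trans (rowLen_anti lam hi.2)⟩
  · intro h
    by_contra h2
    have : colLen lam j ≤ (Finset.Icc 1 (k - 1)).card := by
      apply Finset.card_le_card
      intro i hi
      rw [Finset.mem_filter, Finset.mem_Icc] at hi
      rw [Finset.mem_Icc]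
      refine ⟨hi.1.1, ?_⟩
      by_contra h5
      have := rowLen_anti lam (show k ≤ i by omega)
      omega
    simp at this
    omega

lemma hook_row {n N : ℕ} (lam : Nat.Partition n) (h : lam.parts.card ≤ N) (i : ℕ) (hi : 1 ≤ i) (hiN : i ≤ N) :
    (∏ j ∈ Finset.Icc 1 (rowLen lam i), hookLen lam i j) *
      ∏ k ∈ Finset.Ioc i N, (rowLen lam i - rowLen lam k + (k - i)) = (rowLen lam i + (N - i)).factorial := by
  set f : ℕ → ℕ := fun j => hookLen lam i j with hf
  set g : ℕ → ℕ := fun k => rowLen lam i - rowLen lam k + (k - i) with hg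
  have hcol : ∀ j, 1 ≤ j → j ≤ rowLen lam i → i ≤ colLen lam j := fun j h1 h2 => (le_colLen lam hi h1).1 h2
  have hcanti : ∀ j j', 1 ≤ j → j ≤ j' → colLen lam j' ≤ colLen lam j := by
    intro j j' h1 h2
    by_cases h0 : colLen lam j' = 0
    · omega
    exact (le_colLen lam (by omega) h1).1 (h2.trans ((le_colLen lam (k := colLen lam j') (by omega) (by omega)).2 le_rfl))
  have hcN : ∀ j, 1 ≤ j → colLen lam j ≤ N := by
    intro j h1
    by_contra h2
    have := (le_colLen lam (k := colLen lam j) (by omega) h1).2 le_rfl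
    rw [rowLen_zero lam (by omega)] at this
    omega
  have hfinj : Set.InjOn f (Finset.Icc 1 (rowLen lam i)) := by
    intro j hj j' hj' heq
    simp only [Finset.coe_Icc, Set.mem_Icc] at hj hj'
    have a1 := hcol j hj.1 hj.2
    have a2 := hcol j' hj'.1 hj'.2
    simp only [hf, hookLen] at heq
    rcases le_total j j' with hh | hh
    · have := hcanti j j' hj.1 hh; omega
    · have := hcanti j' j hj'.1 hh; omega
  have hginj : Set.InjOn g (Finset.Ioc i N) := by
    intro j hj j' hj' heq
    simp only [Finset.coe_Ioc, Set.mem_Ioc] at hj hj'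
    have a1 := rowLen_anti lam (show i ≤ j by omega)
    have a2 := rowLen_anti lam (show i ≤ j' by omega)
    simp only [hg] at heq
    rcases le_total j j' with hh | hh
    · have := rowLen_anti lam hh; omega
    · have := rowLen_anti lam hh; omega
  have hdisj : Disjoint ((Finset.Icc 1 (rowLen lam i)).image f) ((Finset.Ioc i N).image g) := by
    rw [Finset.disjoint_left]
    intro x hx hx'
    obtain ⟨j, hj, rfl⟩ := Finset.mem_image.1 hx
    obtain ⟨k, hk, heq⟩ := Finset.mem_image.1 hx'
    rw [Finset.mem_Icc] at hj
    rw [Finset.mem_Ioc] at hk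
    have a1 := hcol j hj.1 hj.2
    have a2 := rowLen_anti lam (show i ≤ k by omega)
    have a3 := le_colLen lam (k := k) (j := j) (by omega) hj.1
    simp only [hf, hg, hookLen] at heq
    omega
  have hunion : (Finset.Icc 1 (rowLen lam i)).image f ∪ (Finset.Ioc i N).image g =
      Finset.Icc 1 (rowLen lam i + (N - i)) := by
    apply Finset.eq_of_subset_of_card_le
    · intro x hx
      rw [Finset.mem_Icc]
      rcases Finset.mem_union.1 hx with hx | hx
      · obtain ⟨j, hj, rfl⟩ := Finset.mem_image.1 hx
        rw [Finset.mem_Icc] at hj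
        have a1 := hcol j hj.1 hj.2
        have a2 := hcN j hj.1
        simp only [hf, hookLen]
        omega
      · obtain ⟨k, hk, rfl⟩ := Finset.mem_image.1 hx
        rw [Finset.mem_Ioc] at hk
        simp only [hg]
        omega
    · rw [Finset.card_union_of_disjoint hdisj, Finset.card_image_of_injOn hfinj, Finset.card_image_of_injOn hginj]
      simp
  rw [← Finset.prod_Ico_id_eq_factorial, Finset.Ico_add_one_right_eq_Icc, ← hunion, Finset.prod_union hdisj, Finset.prod_image hfinj, Finset.prod_image hginj]

lemma hook_row' {n N : ℕ} (lam : Nat.Partition n) (h : lam.parts.card ≤ N) (i : Fin N) :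
    (∏ j ∈ Finset.Icc 1 (rowLen lam (i + 1)), (hookLen lam (i + 1) j : ℝ)) *
      ∏ k ∈ Finset.Ioi i, ((ll N lam i : ℝ) - ll N lam k) = ((ll N lam i).factorial : ℝ) := by
  have h1 := hook_row lam h (i + 1) (by omega) (by omega)
  have h2 : ∏ k ∈ Finset.Ioi i, ((ll N lam i : ℝ) - ll N lam k) =
      ((∏ k ∈ Finset.Ioc ((i : ℕ) + 1) N, (rowLen lam (i + 1) - rowLen lam k + (k - (i + 1))) : ℕ) : ℝ) := by
    push_cast
    refine Finset.prod_bij (fun k _ => (k : ℕ) + 1) ?_ ?_ ?_ ?_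
    · intro k hk
      have : i < k := Finset.mem_Ioi.1 hk
      rw [Fin.lt_def] at this
      rw [Finset.mem_Ioc]; omega
    · intro a _ b _ hab
      exact Fin.ext (by omega)
    · intro k hk
      rw [Finset.mem_Ioc] at hk
      exact ⟨⟨k - 1, by omega⟩, Finset.mem_Ioi.2 (by rw [Fin.lt_def]; simp; omega), by simp; omega⟩
    · intro k hk
      have hik : i < k := Finset.mem_Ioi.1 hk
      rw [Fin.lt_def] at hik
      have := rowLen_anti lam (show (i : ℕ) + 1 ≤ k + 1 by omega)
      have hk2 := k.2
      rw [← Nat.cast_sub (by exact (ll_strict N lam (Finset.mem_Ioi.1 hk)).le), ← Nat.cast_add]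
      congr 1
      unfold ll
      omega
  rw [h2]
  have e : ll N lam i = rowLen lam (i + 1) + (N - (i + 1)) := by unfold ll; omega
  rw [e, ← h1]
  push_cast
  rfl

lemma content_row (N i a : ℕ) (hi : i < N) :
    (∏ j ∈ Finset.Icc 1 a, ((N : ℝ) + (j : ℝ) - ((i + 1 : ℕ) : ℝ))) * ((N - 1 - i).factorial : ℝ) =
      ((a + (N - 1 - i)).factorial : ℝ) := by
  induction a with
  | zero => simp
  | succ a ih =>
    rw [Finset.prod_Icc_succ_top (by omega), mul_right_comm, ih, show a + 1 + (N - 1 - i) = (a + (N - 1 - i)) + 1 by omega,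
      Nat.factorial_succ]
    have : ((N - 1 - i : ℕ) : ℝ) = N - 1 - i := by
      rw [Nat.cast_sub (by omega), Nat.cast_sub (by omega)]; simp
    push_cast
    rw [this]
    ring

lemma VV_sq {N : ℕ} (l : Fin N → ℝ) : VV l ^ 2 = (∏ i, ∏ k ∈ Finset.Ioi i, (l i - l k)) ^ 2 := by
  rw [VV, Matrix.det_vandermonde]
  simp only [← Finset.prod_pow]
  exact Finset.prod_congr rfl fun i _ => Finset.prod_congr rfl fun k _ => by ring

lemma dimE_eq {n N : ℕ} (lam : Nat.Partition n) (h : lam.parts.card ≤ N) :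
    dimE n N lam = ((n.factorial : ℝ) / ∏ i : Fin N, ((N - 1 - (i : ℕ)).factorial : ℝ)) *
      (VV (fun i => (ll N lam i : ℝ)) ^ 2 / ∏ i, ((ll N lam i).factorial : ℝ)) ∧ 0 < dimE n N lam := by
  have hH : (∏ p ∈ cellsOf lam, (hookLen lam p.1 p.2 : ℝ)) * (∏ i, ∏ k ∈ Finset.Ioi i, ((ll N lam i : ℝ) - ll N lam k)) =
      ∏ i, ((ll N lam i).factorial : ℝ) := by
    rw [prod_cells lam h (fun a b => (hookLen lam a b : ℝ)), ← Finset.prod_mul_distrib]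
    exact Finset.prod_congr rfl fun i _ => hook_row' lam h i
  have hC : (∏ p ∈ cellsOf lam, ((N : ℝ) + (p.2 : ℝ) - (p.1 : ℝ))) * (∏ i : Fin N, ((N - 1 - (i : ℕ)).factorial : ℝ)) =
      ∏ i, ((ll N lam i).factorial : ℝ) := by
    rw [prod_cells lam h (fun a b => ((N : ℝ) + (b : ℝ) - (a : ℝ))), ← Finset.prod_mul_distrib]
    exact Finset.prod_congr rfl fun i _ => content_row N i _ i.2
  have hF : 0 < ∏ i, ((ll N lam i).factorial : ℝ) := Finset.prod_pos fun i _ => by positivity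
  have hG : 0 < ∏ i : Fin N, ((N - 1 - (i : ℕ)).factorial : ℝ) := Finset.prod_pos fun i _ => by positivity
  have hH0 : 0 < ∏ p ∈ cellsOf lam, (hookLen lam p.1 p.2 : ℝ) := Finset.prod_pos fun i _ => by
    unfold hookLen; positivity
  rw [VV_sq, dimE]
  set F := ∏ i, ((ll N lam i).factorial : ℝ)
  set Gp := ∏ i : Fin N, ((N - 1 - (i : ℕ)).factorial : ℝ)
  set H := ∏ p ∈ cellsOf lam, (hookLen lam p.1 p.2 : ℝ)
  set C := ∏ p ∈ cellsOf lam, ((N : ℝ) + (p.2 : ℝ) - (p.1 : ℝ))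
  set V := ∏ i, ∏ k ∈ Finset.Ioi i, ((ll N lam i : ℝ) - ll N lam k)
  have hCe : C = F / Gp := by rw [← hC]; field_simp
  have hVe : V = F / H := by rw [← hH]; field_simp
  rw [hCe, hVe]
  constructor
  · field_simp
  · positivity

lemma sum_dimE (n N : ℕ) : ∑ lam ∈ YNN n N, dimE n N lam = (N : ℝ) ^ n := by
  have key : ∀ n, ∑ lam ∈ YNN n N, dimE n N lam = ((n.factorial : ℝ) / ∏ i : Fin N, ((N - 1 - (i : ℕ)).factorial : ℝ)) *
      WW N (n + ∑ i : Fin N, (i : ℕ)) := by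
    intro n
    rw [WW, ← bij_sum n N (fun l => VV (fun i => (l i : ℝ)) ^ 2 / ∏ i, ((l i).factorial : ℝ)), Finset.mul_sum]
    refine Finset.sum_congr rfl fun lam hl => ?_
    exact (dimE_eq lam (by simpa [YNN] using hl)).1
  have h0 : ∑ lam ∈ YNN 0 N, dimE 0 N lam = 1 := by
    have : YNN 0 N = {default} := by
      ext lam
      have : lam = default := Subsingleton.elim _ _
      subst this
      have := card_le (default : Nat.Partition 0)
      simp only [YNN, Finset.mem_filter, Finset.mem_univ, true_and, Finset.mem_singleton]
      simp only [iff_true]; omega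
    rw [this]
    simp [dimE, cellsOf]
  rw [key] at h0
  rw [key n, div_mul_eq_mul_div, WW_eq N n _ rfl, mul_div_assoc]
  rw [Nat.factorial_zero, Nat.cast_one, one_div_mul_eq_div] at h0
  rw [h0, mul_one]

theorem upper_bound_typical :
    ∀ N : ℕ → ℕ, (∀ n, 0 < N n) →
      Tendsto (fun n : ℕ =>
          ∑ lam ∈ (YNN n (N n)).filter (fun lam =>
              -(1/Real.sqrt n) * Real.log (PNN n (N n) lam) < 2*π/Real.sqrt 6),
            PNN n (N n) lam)
        atTop (𝓝 1) := by
  intro N hN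
  refine final N hN ?_ ?_
  · intro n lam hl
    have := (dimE_eq lam (N := N n) (by simpa [YNN] using hl)).2
    have := hN n
    unfold PNN
    positivity
  · intro n
    unfold PNN
    rw [← Finset.sum_div, sum_dimE]
    have : (0 : ℝ) < N n := by exact_mod_cast hN n
    exact div_self (by positivity)
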